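/- arXiv:0906.1858 — 2 statements merged into one kernel-verified Lean document; each statement's English description precedes it below -/
import Mathlib

section
/- Let V₁, V₂, W be real AOU spaces and let Q : V₁ → V₂ be an order quotient map (Q is a unital positive surjective linear map such that for every v₂ ∈ V₂⁺ and ε > 0 there exists v₁ ∈ V₁ with v₁ + ε·e_{V₁} ∈ V₁⁺ and Q(v₁) = v₂). Then Q ⊗ id_W : V₁ ⊗_π W → V₂ ⊗_π W is an order quotient map: it is unital, positive, surjective, and for every z ∈ (V₂ ⊗_π W)⁺ and ε > 0 there exists u ∈ V₁ ⊗ W with u + ε·(e_{V₁} ⊗ e_W) ∈ (V₁ ⊗_π W)⁺ and (Q ⊗ id_W)(u) = z. -/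
open TensorProduct

/-- A real AOU space structure on a real vector space `V`: a proper cone together with
an Archimedean order unit. -/
structure AOU (V : Type*) [AddCommGroup V] [Module ℝ V] where
  pos : Set V
  unit : V
  zero_mem : (0 : V) ∈ pos
  add_mem : ∀ ⦃x y : V⦄, x ∈ pos → y ∈ pos → x + y ∈ pos
  smul_mem : ∀ ⦃r : ℝ⦄, 0 ≤ r → ∀ ⦃x : V⦄, x ∈ pos → r • x ∈ pos
  proper : ∀ x : V, x ∈ pos → -x ∈ pos → x = 0
  exists_orderUnit : ∀ v : V, ∃ r : ℝ, 0 < r ∧ r • unit - v ∈ pos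
  arch : ∀ v : V, (∀ ε : ℝ, 0 < ε → ε • unit + v ∈ pos) → v ∈ pos

variable {V W : Type*} [AddCommGroup V] [Module ℝ V] [AddCommGroup W] [Module ℝ W]

/-- A state on a real AOU space: a unital positive linear functional. -/
def IsState (A : AOU V) (f : V →ₗ[ℝ] ℝ) : Prop :=
  f A.unit = 1 ∧ ∀ v ∈ A.pos, 0 ≤ f v

/-- The tensor product functional `f ⊗ g` on `V ⊗ W`, with `(f ⊗ g)(v ⊗ w) = f v * g w`. -/
noncomputable def tensFun (f : V →ₗ[ℝ] ℝ) (g : W →ₗ[ℝ] ℝ) :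
    TensorProduct ℝ V W →ₗ[ℝ] ℝ :=
  TensorProduct.lift (f.smulRight g)

/-- The injective cone `(V ⊗_ε W)⁺`. -/
def injCone (A : AOU V) (B : AOU W) : Set (TensorProduct ℝ V W) :=
  {z | ∀ (f : V →ₗ[ℝ] ℝ) (g : W →ₗ[ℝ] ℝ), IsState A f → IsState B g → 0 ≤ tensFun f g z}

/-- The set `V⁺ ⊗ W⁺` of finite sums of elementary tensors of positive elements. -/
def simpleCone (A : AOU V) (B : AOU W) : Set (TensorProduct ℝ V W) :=
  {z | ∃ (n : ℕ) (v : Fin n → V) (w : Fin n → W),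
    (∀ i, v i ∈ A.pos) ∧ (∀ i, w i ∈ B.pos) ∧ z = ∑ i, v i ⊗ₜ[ℝ] w i}

/-- The projective cone `(V ⊗_π W)⁺`. -/
def projCone (A : AOU V) (B : AOU W) : Set (TensorProduct ℝ V W) :=
  {z | ∀ ε : ℝ, 0 < ε → z + ε • (A.unit ⊗ₜ[ℝ] B.unit) ∈ simpleCone A B}

/-- The order norm determined by a cone `pos` and order unit `e`. -/
noncomputable def gNorm {X : Type*} [AddCommGroup X] [Module ℝ X]
    (pos : Set X) (e : X) (x : X) : ℝ :=
  sInf {r : ℝ | 0 < r ∧ r • e - x ∈ pos ∧ r • e + x ∈ pos}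

theorem AOU.unit_mem (A : AOU V) : A.unit ∈ A.pos := by
  obtain ⟨r, hr, h⟩ := A.exists_orderUnit 0
  have h' := A.smul_mem (inv_nonneg.2 hr.le) h
  rwa [sub_zero, smul_smul, inv_mul_cancel₀ hr.ne', one_smul] at h'

theorem sum_tmul_mem_simpleCone {ι : Type*} [Fintype ι] {A : AOU V} {B : AOU W}
    {v : ι → V} {w : ι → W} (hv : ∀ i, v i ∈ A.pos) (hw : ∀ i, w i ∈ B.pos) :
    ∑ i, v i ⊗ₜ[ℝ] w i ∈ simpleCone A B :=
  ⟨Fintype.card ι, v ∘ (Fintype.equivFin ι).symm, w ∘ (Fintype.equivFin ι).symm,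
    fun _ => hv _, fun _ => hw _,
    ((Fintype.equivFin ι).symm.sum_comp fun i => v i ⊗ₜ[ℝ] w i).symm⟩

theorem tmul_mem_simpleCone {A : AOU V} {B : AOU W} {v : V} {w : W}
    (hv : v ∈ A.pos) (hw : w ∈ B.pos) : v ⊗ₜ[ℝ] w ∈ simpleCone A B := by
  simpa using sum_tmul_mem_simpleCone (ι := Unit) (fun _ => hv) (fun _ => hw)

theorem simpleCone_add_mem {A : AOU V} {B : AOU W} {x y : V ⊗[ℝ] W}
    (hx : x ∈ simpleCone A B) (hy : y ∈ simpleCone A B) : x + y ∈ simpleCone A B := by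
  obtain ⟨m, v, w, hv, hw, rfl⟩ := hx
  obtain ⟨n, v', w', hv', hw', rfl⟩ := hy
  simpa using sum_tmul_mem_simpleCone (A := A) (B := B)
    (v := Sum.elim v v') (w := Sum.elim w w')
    (Sum.forall.2 ⟨hv, hv'⟩) (Sum.forall.2 ⟨hw, hw'⟩)

theorem simpleCone_subset_projCone (A : AOU V) (B : AOU W) :
    simpleCone A B ⊆ projCone A B := fun z hz ε hε => by
  rw [smul_tmul']
  exact simpleCone_add_mem hz (tmul_mem_simpleCone (A.smul_mem hε.le A.unit_mem) B.unit_mem)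

theorem map_mem_simpleCone {V₂ : Type*} [AddCommGroup V₂] [Module ℝ V₂]
    {A₁ : AOU V} {A₂ : AOU V₂} {B : AOU W} {Q : V →ₗ[ℝ] V₂}
    (hp : ∀ v ∈ A₁.pos, Q v ∈ A₂.pos) {z : V ⊗[ℝ] W} (hz : z ∈ simpleCone A₁ B) :
    TensorProduct.map Q LinearMap.id z ∈ simpleCone A₂ B := by
  obtain ⟨n, v, w, hv, hw, rfl⟩ := hz
  simpa using sum_tmul_mem_simpleCone (fun i => hp _ (hv i)) hw

/-- Elements of the simple cone lift along an order quotient map, up to any multiple of the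
order unit. -/
theorem exists_lift_add_smul_mem_simpleCone {V₂ : Type*} [AddCommGroup V₂] [Module ℝ V₂]
    {A₁ : AOU V} {A₂ : AOU V₂} {B : AOU W} {Q : V →ₗ[ℝ] V₂}
    (hq : ∀ v₂ ∈ A₂.pos, ∀ ε : ℝ, 0 < ε →
      ∃ v₁ : V, v₁ + ε • A₁.unit ∈ A₁.pos ∧ Q v₁ = v₂)
    {z : V₂ ⊗[ℝ] W} (hz : z ∈ simpleCone A₂ B) {ε : ℝ} (hε : 0 < ε) :
    ∃ u : V ⊗[ℝ] W, u + ε • (A₁.unit ⊗ₜ[ℝ] B.unit) ∈ simpleCone A₁ B ∧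
      TensorProduct.map Q LinearMap.id u = z := by
  obtain ⟨n, v, w, hv, hw, rfl⟩ := hz
  obtain ⟨r, hr, hrw⟩ := B.exists_orderUnit (∑ i, w i)
  have hδ : 0 < ε / r := div_pos hε hr
  choose v' hv' hQ using fun i => hq (v i) (hv i) (ε / r) hδ
  refine ⟨∑ i, v' i ⊗ₜ[ℝ] w i, ?_, by simp [hQ]⟩
  have h := simpleCone_add_mem (sum_tmul_mem_simpleCone hv' hw)
    (tmul_mem_simpleCone (A₁.smul_mem hδ.le A₁.unit_mem) hrw)
  convert h using 1
  simp only [add_tmul, Finset.sum_add_distrib, tmul_sub, tmul_sum, tmul_smul, ← smul_tmul',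
    smul_smul, mul_div_cancel₀ ε hr.ne']
  abel

/-- the projective tensor product with a fixed real AOU space preserves
order quotient maps. -/
theorem projective_tensor_preserves_quotient
    {V₁ V₂ : Type*}
    [AddCommGroup V₁] [Module ℝ V₁] [AddCommGroup V₂] [Module ℝ V₂]
    (A₁ : AOU V₁) (A₂ : AOU V₂) (B : AOU W)
    (Q : V₁ →ₗ[ℝ] V₂)
    (hu : Q A₁.unit = A₂.unit) (hp : ∀ v ∈ A₁.pos, Q v ∈ A₂.pos)
    (hsurj : Function.Surjective Q)
    (hq : ∀ v₂ ∈ A₂.pos, ∀ ε : ℝ, 0 < ε →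
      ∃ v₁ : V₁, v₁ + ε • A₁.unit ∈ A₁.pos ∧ Q v₁ = v₂) :
    TensorProduct.map Q (LinearMap.id : W →ₗ[ℝ] W) (A₁.unit ⊗ₜ[ℝ] B.unit)
      = A₂.unit ⊗ₜ[ℝ] B.unit ∧
    (∀ z ∈ projCone A₁ B,
      TensorProduct.map Q (LinearMap.id : W →ₗ[ℝ] W) z ∈ projCone A₂ B) ∧
    Function.Surjective (TensorProduct.map Q (LinearMap.id : W →ₗ[ℝ] W)) ∧
    ∀ z ∈ projCone A₂ B, ∀ ε : ℝ, 0 < ε →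
      ∃ u : TensorProduct ℝ V₁ W,
        u + ε • (A₁.unit ⊗ₜ[ℝ] B.unit) ∈ projCone A₁ B ∧
        TensorProduct.map Q (LinearMap.id : W →ₗ[ℝ] W) u = z := by
  have hunit : TensorProduct.map Q (LinearMap.id : W →ₗ[ℝ] W) (A₁.unit ⊗ₜ[ℝ] B.unit)
      = A₂.unit ⊗ₜ[ℝ] B.unit := by simp [hu]
  refine ⟨hunit, fun z hz ε hε => ?_,
    TensorProduct.map_surjective hsurj Function.surjective_id, fun z hz ε hε => ?_⟩
  · simpa only [map_add, map_smul, hunit] using map_mem_simpleCone hp (hz ε hε)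
  · obtain ⟨u, hmem, hmap⟩ :=
      exists_lift_add_smul_mem_simpleCone hq (hz (ε / 2) (half_pos hε)) (half_pos hε)
    refine ⟨u - (ε / 2) • (A₁.unit ⊗ₜ[ℝ] B.unit), simpleCone_subset_projCone A₁ B ?_, ?_⟩
    · convert hmem using 1
      module
    · rw [map_sub, map_smul, hunit, hmap, add_sub_cancel_right]
end

section
/- Let V and W be real AOU spaces, each equipped with its order norm. Then for every z ∈ V ⊗ W, the order norm of z in the injective tensor product V ⊗_ε W equals the injective (Banach) tensor norm of z, namely λ(z) = sup{ |(f ⊗ g)(z)| : f is a linear functional on V with ‖f‖ ≤ 1, g is a linear functional on W with ‖g‖ ≤ 1 }, where the functional norms are the operator norms with respect to the order norms. -/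
open TensorProduct

variable {V W : Type*} [AddCommGroup V] [Module ℝ V] [AddCommGroup W] [Module ℝ W]

namespace AOU

theorem unit_mem_s10 (A : AOU V) : A.unit ∈ A.pos := by
  obtain ⟨r, hr, h⟩ := A.exists_orderUnit 0
  have := A.smul_mem (inv_nonneg.2 hr.le) h
  rwa [sub_zero, smul_smul, inv_mul_cancel₀ hr.ne', one_smul] at this

theorem smul_unit_add_mem_of_le (A : AOU V) {r s : ℝ} (hrs : r ≤ s) {v : V}
    (h : r • A.unit + v ∈ A.pos) : s • A.unit + v ∈ A.pos := by
  have := A.add_mem h (A.smul_mem (sub_nonneg.2 hrs) A.unit_mem_s10)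
  convert this using 1
  module

/-- The smallest cone containing `A.pos` and `-x`. -/
def adjoinNeg (A : AOU V) (x : V) : PointedCone ℝ V where
  carrier := {y | ∃ c : ℝ, 0 ≤ c ∧ y + c • x ∈ A.pos}
  zero_mem' := ⟨0, le_rfl, by simpa using A.zero_mem⟩
  add_mem' := by
    rintro y z ⟨c, hc, hy⟩ ⟨d, hd, hz⟩
    refine ⟨c + d, by positivity, ?_⟩
    convert A.add_mem hy hz using 1
    module
  smul_mem' := by
    rintro ⟨r, hr⟩ y ⟨c, hc, hy⟩
    refine ⟨r * c, by positivity, ?_⟩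
    convert A.smul_mem hr hy using 1
    change r • y + _ = _
    module

/-- A vector on which every state is nonnegative is positive. -/
theorem mem_pos_of_forall_isState (A : AOU V) {v : V}
    (h : ∀ φ : V →ₗ[ℝ] ℝ, IsState A φ → 0 ≤ φ v) : v ∈ A.pos := by
  refine A.arch v fun ε hε => ?_
  by_contra hx
  have hx' {r : ℝ} (hr : r ≤ ε) : r • A.unit + v ∉ A.pos :=
    fun h => hx (A.smul_unit_add_mem_of_le hr h)
  have hunit : A.unit ≠ 0 := by
    intro h0
    obtain ⟨r, -, hr⟩ := A.exists_orderUnit (-v)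
    rw [h0, smul_zero, zero_sub, neg_neg] at hr
    exact hx (by simpa [h0] using hr)
  set x := ε • A.unit + v with hxdef
  obtain ⟨φ, hφ, hpos⟩ := riesz_extension (A.adjoinNeg x)
    (LinearPMap.mkSpanSingleton A.unit (1 : ℝ) hunit) (by
      rintro ⟨y, hy⟩ ⟨c, hc, hmem⟩
      obtain ⟨t, rfl⟩ := Submodule.mem_span_singleton.1 hy
      rw [LinearPMap.mkSpanSingleton'_apply]
      simp only [RingHom.id_apply, smul_eq_mul, mul_one]
      by_contra! ht
      rcases hc.eq_or_lt with rfl | hc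
      · simp only [zero_smul, add_zero] at hmem
        refine hunit (A.proper _ A.unit_mem_s10 ?_)
        have := A.smul_mem (inv_nonneg.2 (neg_nonneg.2 ht.le)) hmem
        rwa [smul_smul, inv_neg, neg_mul, inv_mul_cancel₀ ht.ne, neg_one_smul] at this
      · have := A.smul_mem (inv_nonneg.2 hc.le) hmem
        refine hx' (r := c⁻¹ * t + ε) ?_ ?_
        · have := mul_neg_of_pos_of_neg (inv_pos.2 hc) ht
          linarith
        · convert this using 1
          rw [smul_add, smul_smul, smul_smul, inv_mul_cancel₀ hc.ne', hxdef]
          module) (by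
      intro y
      obtain ⟨r, -, hr⟩ := A.exists_orderUnit (-y)
      refine ⟨⟨r • A.unit, Submodule.mem_span_singleton.2 ⟨r, rfl⟩⟩, 0, le_rfl, ?_⟩
      simpa using hr)
  have hφunit : φ A.unit = 1 := by
    rw [hφ ⟨A.unit, Submodule.mem_span_singleton_self _⟩]
    exact LinearPMap.mkSpanSingleton_apply ℝ ℝ hunit 1
  have hφv := h φ ⟨hφunit, fun y hy => hpos y ⟨0, le_rfl, by simpa using hy⟩⟩
  have hφx := hpos (-x) ⟨1, zero_le_one, by simpa using A.zero_mem⟩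
  rw [map_neg, hxdef, map_add, map_smul, hφunit, smul_eq_mul] at hφx
  linarith

theorem exists_abs_le (A : AOU V) (v : V) :
    ∃ r : ℝ, 0 < r ∧ r • A.unit - v ∈ A.pos ∧ r • A.unit + v ∈ A.pos := by
  obtain ⟨r, hr, h⟩ := A.exists_orderUnit v
  obtain ⟨s, -, h'⟩ := A.exists_orderUnit (-v)
  rw [sub_eq_add_neg] at h h'
  rw [neg_neg] at h'
  refine ⟨max r s, lt_max_of_lt_left hr, ?_, A.smul_unit_add_mem_of_le (le_max_right _ _) h'⟩
  rw [sub_eq_add_neg]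
  exact A.smul_unit_add_mem_of_le (le_max_left _ _) h

end AOU

theorem gNorm_le {X : Type*} [AddCommGroup X] [Module ℝ X] {pos : Set X} {e x : X} {r : ℝ}
    (hr : 0 ≤ r) (h : ∀ s, r < s → s • e - x ∈ pos ∧ s • e + x ∈ pos) : gNorm pos e x ≤ r := by
  refine le_of_forall_gt_imp_ge_of_dense fun s hs => ?_
  exact csInf_le ⟨0, fun _ ht => ht.1.le⟩ ⟨hr.trans_lt hs, h s hs⟩

theorem IsState.abs_le {A : AOU V} {φ : V →ₗ[ℝ] ℝ} (hφ : IsState A φ) {v : V} {r : ℝ}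
    (h : r • A.unit - v ∈ A.pos) (h' : r • A.unit + v ∈ A.pos) : |φ v| ≤ r := by
  have h := hφ.2 _ h
  have h' := hφ.2 _ h'
  simp only [map_sub, map_add, map_smul, hφ.1, smul_eq_mul, mul_one] at h h'
  exact _root_.abs_le.2 ⟨by linarith, by linarith⟩

theorem IsState.abs_le_gNorm {A : AOU V} {φ : V →ₗ[ℝ] ℝ} (hφ : IsState A φ) (v : V) :
    |φ v| ≤ gNorm A.pos A.unit v :=
  le_csInf (A.exists_abs_le v) fun _ hr => hφ.abs_le hr.2.1 hr.2.2

/-- The order norm is dominated by any uniform bound for the states. -/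
theorem gNorm_le_of_forall_isState (A : AOU V) {v : V} {r : ℝ} (hr : 0 ≤ r)
    (h : ∀ φ : V →ₗ[ℝ] ℝ, IsState A φ → |φ v| ≤ r) : gNorm A.pos A.unit v ≤ r := by
  refine gNorm_le hr fun s hs => ⟨?_, ?_⟩ <;>
  · refine A.mem_pos_of_forall_isState fun φ hφ => ?_
    have := abs_le.1 (h φ hφ)
    simp only [map_sub, map_add, map_smul, hφ.1, smul_eq_mul, mul_one]
    linarith

@[simp]
theorem tensFun_tmul (f : V →ₗ[ℝ] ℝ) (g : W →ₗ[ℝ] ℝ) (v : V) (w : W) :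
    tensFun f g (v ⊗ₜ[ℝ] w) = f v * g w := by
  simp [tensFun]

theorem exists_tensFun_eq_left (g : W →ₗ[ℝ] ℝ) (z : V ⊗[ℝ] W) :
    ∃ v : V, ∀ f : V →ₗ[ℝ] ℝ, tensFun f g z = f v := by
  induction z with
  | zero => exact ⟨0, by simp⟩
  | tmul v w => exact ⟨g w • v, by simp [mul_comm]⟩
  | add x y hx hy =>
    obtain ⟨v, hv⟩ := hx
    obtain ⟨w, hw⟩ := hy
    exact ⟨v + w, fun f => by rw [map_add, map_add, hv, hw]⟩

theorem exists_tensFun_eq_right (f : V →ₗ[ℝ] ℝ) (z : V ⊗[ℝ] W) :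
    ∃ w : W, ∀ g : W →ₗ[ℝ] ℝ, tensFun f g z = g w := by
  induction z with
  | zero => exact ⟨0, by simp⟩
  | tmul v w => exact ⟨f v • w, by simp⟩
  | add x y hx hy =>
    obtain ⟨v, hv⟩ := hx
    obtain ⟨w, hw⟩ := hy
    exact ⟨v + w, fun f => by rw [map_add, map_add, hv, hw]⟩

/-- A bound for `φ ⊗ ψ` over states extends to all pairs of contractive functionals. -/
theorem abs_tensFun_le_of_forall_isState (A : AOU V) (B : AOU W) {z : V ⊗[ℝ] W} {r : ℝ}
    (hr : 0 ≤ r) (h : ∀ φ ψ, IsState A φ → IsState B ψ → |tensFun φ ψ z| ≤ r)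
    {f : V →ₗ[ℝ] ℝ} {g : W →ₗ[ℝ] ℝ} (hf : ∀ v, |f v| ≤ gNorm A.pos A.unit v)
    (hg : ∀ w, |g w| ≤ gNorm B.pos B.unit w) : |tensFun f g z| ≤ r := by
  obtain ⟨v, hv⟩ := exists_tensFun_eq_left g z
  rw [hv]
  refine (hf v).trans (gNorm_le_of_forall_isState A hr fun φ hφ => ?_)
  obtain ⟨w, hw⟩ := exists_tensFun_eq_right φ z
  rw [← hv, hw]
  refine (hg w).trans (gNorm_le_of_forall_isState B hr fun ψ hψ => ?_)
  rw [← hw]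
  exact h φ ψ hφ hψ

theorem exists_forall_isState_abs_tensFun_le (A : AOU V) (B : AOU W) (z : V ⊗[ℝ] W) :
    ∃ r : ℝ, 0 < r ∧ ∀ φ ψ, IsState A φ → IsState B ψ → |tensFun φ ψ z| ≤ r := by
  induction z with
  | zero => exact ⟨1, one_pos, by simp⟩
  | tmul v w =>
    obtain ⟨r, hr, h₁, h₂⟩ := A.exists_abs_le v
    obtain ⟨s, hs, h₃, h₄⟩ := B.exists_abs_le w
    refine ⟨r * s, mul_pos hr hs, fun φ ψ hφ hψ => ?_⟩
    rw [tensFun_tmul, abs_mul]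
    exact mul_le_mul (hφ.abs_le h₁ h₂) (hψ.abs_le h₃ h₄) (abs_nonneg _) hr.le
  | add x y hx hy =>
    obtain ⟨r, hr, h⟩ := hx
    obtain ⟨s, hs, h'⟩ := hy
    refine ⟨r + s, add_pos hr hs, fun φ ψ hφ hψ => ?_⟩
    rw [map_add]
    exact (abs_add_le _ _).trans (add_le_add (h φ ψ hφ hψ) (h' φ ψ hφ hψ))

theorem mem_injCone_iff_forall_abs_le (A : AOU V) (B : AOU W) (z : V ⊗[ℝ] W) (r : ℝ) :
    (r • (A.unit ⊗ₜ[ℝ] B.unit) - z ∈ injCone A B ∧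
      r • (A.unit ⊗ₜ[ℝ] B.unit) + z ∈ injCone A B) ↔
      ∀ φ ψ, IsState A φ → IsState B ψ → |tensFun φ ψ z| ≤ r := by
  constructor
  · rintro ⟨h, h'⟩ φ ψ hφ hψ
    have h := h φ ψ hφ hψ
    have h' := h' φ ψ hφ hψ
    simp only [map_sub, map_add, map_smul, tensFun_tmul, hφ.1, hψ.1, smul_eq_mul, mul_one] at h h'
    exact abs_le.2 ⟨by linarith, by linarith⟩
  · refine fun h => ⟨fun φ ψ hφ hψ => ?_, fun φ ψ hφ hψ => ?_⟩ <;>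
    · have := abs_le.1 (h φ ψ hφ hψ)
      simp only [map_sub, map_add, map_smul, tensFun_tmul, hφ.1, hψ.1, smul_eq_mul, mul_one]
      linarith

/-- the order norm of the injective tensor product of real AOU spaces
coincides with the injective Banach-space tensor norm for the order norms. -/
theorem injective_order_norm_eq_injective_tensor_norm
    (A : AOU V) (B : AOU W) (z : TensorProduct ℝ V W) :
    gNorm (injCone A B) (A.unit ⊗ₜ[ℝ] B.unit) z =
      sSup {r : ℝ | ∃ (f : V →ₗ[ℝ] ℝ) (g : W →ₗ[ℝ] ℝ),
        (∀ v : V, |f v| ≤ gNorm A.pos A.unit v) ∧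
        (∀ w : W, |g w| ≤ gNorm B.pos B.unit w) ∧
        r = |tensFun f g z|} := by
  obtain ⟨r, hr, h⟩ := exists_forall_isState_abs_tensFun_le A B z
  apply le_antisymm
  · refine gNorm_le (Real.sSup_nonneg ?_) fun s hs => ?_
    · rintro _ ⟨f, g, -, -, rfl⟩
      exact abs_nonneg _
    · refine (mem_injCone_iff_forall_abs_le A B z s).2 fun φ ψ hφ hψ => le_trans ?_ hs.le
      refine le_csSup ⟨r, ?_⟩ ⟨φ, ψ, hφ.abs_le_gNorm, hψ.abs_le_gNorm, rfl⟩
      rintro _ ⟨f, g, hf, hg, rfl⟩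
      exact abs_tensFun_le_of_forall_isState A B hr.le h hf hg
  · refine le_csInf ⟨r, hr, (mem_injCone_iff_forall_abs_le A B z r).2 h⟩ fun s hs => ?_
    refine Real.sSup_le ?_ hs.1.le
    rintro _ ⟨f, g, hf, hg, rfl⟩
    exact abs_tensFun_le_of_forall_isState A B hs.1.le
      ((mem_injCone_iff_forall_abs_le A B z s).1 hs.2) hf hg
end
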